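/- arXiv:2410.23424 — 6 statements merged into one kernel-verified Lean document; each statement's English description precedes it below -/
import Mathlib

section
/- Let d be a positive integer, f : ℝ^d → ℝ a differentiable function whose gradient is M-Lipschitz (M > 0) and which is bounded below by f* (f(x) ≥ f* for all x). Let γ > 0, P ∈ [0,1), c ≥ 0, R ≥ 0, and let T be a natural number. Suppose sequences w_0,…,w_T, w̃_0,…,w̃_{T+1}, g_0,…,g_T in ℝ^d satisfy, for every 0 ≤ t ≤ T: (i) w̃_{t+1} = w̃_t − γ g_t; (ii) ‖w_t − w̃_t‖² ≤ R; (iii) ‖g_t − ∇f(w_t)‖² ≤ P‖∇f(w_t)‖² + c. Set ρ̃ = (1−P)/2 − γ(M+1)(1+P) and assume ρ̃ > 0. Then (1/(T+1)) ∑_{t=0}^{T} ‖∇f(w_t)‖² ≤ (1/ρ̃)·[ (f(w̃_0) − f*)/(γ(T+1)) + M²R/(2γ) + (1/2 + γ(M+1))·c ]. -/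
open Finset

section DescentLemma

variable {E : Type*} [NormedAddCommGroup E] [InnerProductSpace ℝ E]

/-- The descent lemma: a function with `M`-Lipschitz gradient lies below its quadratic
upper model. -/
theorem descent_lemma [CompleteSpace E] {f : E → ℝ} {f' : E → E} {M : ℝ}
    (hgrad : ∀ x, HasGradientAt f (f' x) x)
    (hlip : ∀ x y, ‖f' x - f' y‖ ≤ M * ‖x - y‖) (x v : E) :
    f (x + v) ≤ f x + inner ℝ (f' x) v + M / 2 * ‖v‖ ^ 2 := by
  have hline (s : ℝ) : HasDerivAt (fun s : ℝ => x + s • v) v s := by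
    simpa using ((hasDerivAt_id s).smul_const v).const_add x
  have hderiv (s : ℝ) : HasDerivAt
      (fun s : ℝ => f (x + s • v) - s * inner ℝ (f' x) v - M / 2 * ‖v‖ ^ 2 * s ^ 2)
      (inner ℝ (f' (x + s • v)) v - inner ℝ (f' x) v - M * ‖v‖ ^ 2 * s) s := by
    have h₁ : HasDerivAt (fun s : ℝ => f (x + s • v)) (inner ℝ (f' (x + s • v)) v) s := by
      simpa [Function.comp_def] using (hgrad (x + s • v)).hasFDerivAt.comp_hasDerivAt s (hline s)
    refine ((h₁.sub ((hasDerivAt_id s).mul_const (inner ℝ (f' x) v))).sub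
      ((hasDerivAt_pow 2 s).const_mul (M / 2 * ‖v‖ ^ 2))).congr_deriv ?_
    push_cast
    ring
  have hanti : AntitoneOn
      (fun s : ℝ => f (x + s • v) - s * inner ℝ (f' x) v - M / 2 * ‖v‖ ^ 2 * s ^ 2)
      (Set.Icc 0 1) := by
    refine antitoneOn_of_deriv_nonpos (convex_Icc 0 1)
      (fun s _ => (hderiv s).continuousAt.continuousWithinAt)
      (fun s _ => (hderiv s).differentiableAt.differentiableWithinAt) fun s hs => ?_
    rw [interior_Icc] at hs
    rw [(hderiv s).deriv, ← inner_sub_left]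
    have h := hlip (x + s • v) x
    rw [add_sub_cancel_left, norm_smul, Real.norm_of_nonneg hs.1.le] at h
    have h₂ := real_inner_le_norm (f' (x + s • v) - f' x) v
    have h₃ := mul_le_mul_of_nonneg_right h (norm_nonneg v)
    linarith
  have h := hanti (Set.left_mem_Icc.2 zero_le_one) (Set.right_mem_Icc.2 zero_le_one) zero_le_one
  simp only [one_smul, zero_smul, add_zero] at h
  linarith

/-- One step `y ↦ y - γ • g` of gradient descent, where `g` approximates the gradient at a
point `x` near `y`. -/
theorem inexact_gradient_step [CompleteSpace E] {f : E → ℝ} {f' : E → E} {M γ P c R : ℝ}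
    (hgrad : ∀ x, HasGradientAt f (f' x) x) (hM : 0 ≤ M)
    (hlip : ∀ x y, ‖f' x - f' y‖ ≤ M * ‖x - y‖) (hγ : 0 ≤ γ) {x y g : E}
    (hres : ‖x - y‖ ^ 2 ≤ R) (herr : ‖g - f' x‖ ^ 2 ≤ P * ‖f' x‖ ^ 2 + c) :
    γ * ((1 - P) / 2 - γ * (M + 1) * (1 + P)) * ‖f' x‖ ^ 2 ≤
      f y - f (y - γ • g) + (M ^ 2 * R / 2 + γ * ((1 / 2 + γ * (M + 1)) * c)) := by
  have hdesc := descent_lemma hgrad hlip y (-(γ • g))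
  rw [← sub_eq_add_neg, inner_neg_right, norm_neg, inner_smul_right, norm_smul,
    Real.norm_of_nonneg hγ, mul_pow] at hdesc
  have hshift : ‖f' y - f' x‖ ^ 2 ≤ M ^ 2 * R := by
    calc ‖f' y - f' x‖ ^ 2 ≤ (M * ‖y - x‖) ^ 2 := by gcongr; exact hlip y x
      _ = M ^ 2 * ‖x - y‖ ^ 2 := by rw [mul_pow, norm_sub_rev]
      _ ≤ M ^ 2 * R := by gcongr
  have hcross : 0 ≤ ‖f' y - f' x‖ ^ 2 + 2 * γ * inner ℝ (f' y - f' x) g + γ ^ 2 * ‖g‖ ^ 2 := by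
    have h := norm_add_sq_real (f' y - f' x) (γ • g)
    rw [inner_smul_right, norm_smul, Real.norm_of_nonneg hγ, mul_pow] at h
    linarith [sq_nonneg ‖f' y - f' x + γ • g‖]
  rw [inner_sub_left] at hcross
  have herr_eq := norm_sub_sq_real g (f' x)
  have hg : ‖g‖ ^ 2 ≤ 2 * ((1 + P) * ‖f' x‖ ^ 2 + c) := by
    have h := parallelogram_law_with_norm ℝ (g - f' x) (f' x)
    rw [sub_add_cancel] at h
    linarith [mul_self_nonneg ‖g - f' x - f' x‖]
  rw [real_inner_comm] at herr_eq
  have h₁ : γ * ((1 - P) * ‖f' x‖ ^ 2 - c) ≤ γ * (2 * inner ℝ (f' x) g) := by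
    refine mul_le_mul_of_nonneg_left ?_ hγ
    linarith [sq_nonneg ‖g‖]
  have h₂ : γ ^ 2 * (M + 1) * ‖g‖ ^ 2 ≤
      γ ^ 2 * (M + 1) * (2 * ((1 + P) * ‖f' x‖ ^ 2 + c)) := by gcongr
  linarith

end DescentLemma

/-- deterministic form of the FPS convergence theorem, Theorem 1:
gradient descent with a (1+P, c)-inexact gradient and sketching residual `R` drives the
average squared gradient norm into a neighborhood controlled by `R` and `c`. -/
theorem fps_convergence
    (d : ℕ) (hd : 0 < d)
    (f : EuclideanSpace ℝ (Fin d) → ℝ)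
    (f' : EuclideanSpace ℝ (Fin d) → EuclideanSpace ℝ (Fin d))
    (hgrad : ∀ x, HasGradientAt f (f' x) x)
    (M : ℝ) (hM : 0 < M)
    (hlip : ∀ x y, ‖f' x - f' y‖ ≤ M * ‖x - y‖)
    (fstar : ℝ) (hbdd : ∀ x, fstar ≤ f x)
    (γ : ℝ) (hγ : 0 < γ)
    (P : ℝ) (hP0 : 0 ≤ P) (hP1 : P < 1)
    (c : ℝ) (hc : 0 ≤ c)
    (R : ℝ) (hR : 0 ≤ R)
    (T : ℕ)
    (w wt g : ℕ → EuclideanSpace ℝ (Fin d))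
    (hupd : ∀ t ≤ T, wt (t + 1) = wt t - γ • g t)
    (hres : ∀ t ≤ T, ‖w t - wt t‖ ^ 2 ≤ R)
    (herr : ∀ t ≤ T, ‖g t - f' (w t)‖ ^ 2 ≤ P * ‖f' (w t)‖ ^ 2 + c)
    (ρ : ℝ) (hρdef : ρ = (1 - P) / 2 - γ * (M + 1) * (1 + P))
    (hρpos : 0 < ρ) :
    (1 / ((T : ℝ) + 1)) * ∑ t ∈ Finset.range (T + 1), ‖f' (w t)‖ ^ 2 ≤
      (1 / ρ) * ((f (wt 0) - fstar) / (γ * ((T : ℝ) + 1))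
        + M ^ 2 * R / (2 * γ) + (1 / 2 + γ * (M + 1)) * c) := by
  subst hρdef
  set ρ := (1 - P) / 2 - γ * (M + 1) * (1 + P)
  set K := M ^ 2 * R / 2 + γ * ((1 / 2 + γ * (M + 1)) * c) with hK
  have hsum : γ * ρ * ∑ t ∈ Finset.range (T + 1), ‖f' (w t)‖ ^ 2 ≤
      f (wt 0) - fstar + (T + 1) * K := by
    calc γ * ρ * ∑ t ∈ Finset.range (T + 1), ‖f' (w t)‖ ^ 2
        ≤ ∑ t ∈ Finset.range (T + 1), (f (wt t) - f (wt (t + 1)) + K) := by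
          rw [Finset.mul_sum]
          refine Finset.sum_le_sum fun t ht => ?_
          have ht' : t ≤ T := Nat.lt_succ_iff.1 (Finset.mem_range.1 ht)
          rw [hupd t ht']
          exact inexact_gradient_step hgrad hM.le hlip hγ.le (hres t ht') (herr t ht')
      _ = f (wt 0) - f (wt (T + 1)) + (T + 1) * K := by
          rw [Finset.sum_add_distrib, Finset.sum_range_sub']
          simp
      _ ≤ f (wt 0) - fstar + (T + 1) * K := by linarith [hbdd (wt (T + 1))]
  have hT : (0 : ℝ) < T + 1 := by positivity
  calc (1 / ((T : ℝ) + 1)) * ∑ t ∈ Finset.range (T + 1), ‖f' (w t)‖ ^ 2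
      = (γ * ρ * ∑ t ∈ Finset.range (T + 1), ‖f' (w t)‖ ^ 2) / (γ * ρ * (T + 1)) := by
        field_simp
    _ ≤ (f (wt 0) - fstar + (T + 1) * K) / (γ * ρ * (T + 1)) := by gcongr
    _ = _ := by
        rw [hK]
        field_simp
        ring
end

section
/- Let d, k be integers with 1 ≤ k ≤ d, let p > 1/2, c > 0, W ≥ 0, and let w, w̃ ∈ ℝ^d satisfy: (i) ‖w‖² ≤ W; (ii) |w(i)| ≤ i^{−p}·‖w‖ for every coordinate i with k+1 ≤ i ≤ d (power-law decay of the sorted coordinates); (iii) w̃(i) = 0 for every i > k; (iv) |w(i) − w̃(i)| ≤ ‖w‖/√(c·k) for every i ≤ k. Then ‖w − w̃‖² ≤ ( 1/c + (k^{1−2p} − d^{1−2p})/(2p−1) )·W. -/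
open Finset

/-- Integral comparison for a block of the series with terms `n ^ (-s)`, where `1 < s`. -/
theorem sum_Ico_rpow_neg_le {k d : ℕ} (hk : 1 ≤ k) (hkd : k ≤ d) {s : ℝ} (hs : 1 < s) :
    ∑ i ∈ Ico k d, ((i : ℝ) + 1) ^ (-s) ≤
      ((k : ℝ) ^ (1 - s) - (d : ℝ) ^ (1 - s)) / (s - 1) := by
  have hk0 : (0 : ℝ) < k := by exact_mod_cast hk
  have hkd' : (k : ℝ) ≤ d := by exact_mod_cast hkd
  have hanti : AntitoneOn (fun x : ℝ => x ^ (-s)) (Set.Icc k d) := fun x hx y _ hxy =>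
    Real.rpow_le_rpow_of_nonpos (hk0.trans_le hx.1) hxy (by linarith)
  have hsum := hanti.sum_le_integral_Ico hkd
  have h0 : (0 : ℝ) ∉ Set.uIcc (k : ℝ) d := by
    rw [Set.uIcc_of_le hkd']
    exact fun h => hk0.not_ge h.1
  rw [integral_rpow (Or.inr ⟨by linarith, h0⟩)] at hsum
  push_cast at hsum
  refine hsum.trans_eq ?_
  rw [show -s + 1 = -(s - 1) by ring, show 1 - s = -(s - 1) by ring, div_neg, ← neg_div, neg_sub]

/-- Lemma 1 of the paper: residual error after extracting the top-`k`
coordinates from a count sketch, for a power-law compressible vector.  Coordinates are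
1-indexed: coordinate `i : Fin d` corresponds to index `(i : ℕ) + 1 ∈ {1, …, d}`. -/
theorem count_sketch_residual
    (d k : ℕ) (hk1 : 1 ≤ k) (hkd : k ≤ d)
    (p : ℝ) (hp : 1 / 2 < p)
    (c : ℝ) (hc : 0 < c)
    (W : ℝ) (hW : 0 ≤ W)
    (w wt : EuclideanSpace ℝ (Fin d))
    (hnorm : ‖w‖ ^ 2 ≤ W)
    (hpow : ∀ i : Fin d, k + 1 ≤ (i : ℕ) + 1 → |w i| ≤ (((i : ℕ) + 1 : ℝ)) ^ (-p) * ‖w‖)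
    (htail : ∀ i : Fin d, k < (i : ℕ) + 1 → wt i = 0)
    (htop : ∀ i : Fin d, (i : ℕ) + 1 ≤ k → |w i - wt i| ≤ ‖w‖ / Real.sqrt (c * k)) :
    ‖w - wt‖ ^ 2 ≤
      (1 / c + ((k : ℝ) ^ (1 - 2 * p) - (d : ℝ) ^ (1 - 2 * p)) / (2 * p - 1)) * W := by
  set g : ℕ → ℝ := fun i => if i < k then 1 / (c * k) else ((i : ℝ) + 1) ^ (-(2 * p)) with hg
  have hk0 : (0 : ℝ) < k := by exact_mod_cast hk1
  have hg0 : ∀ i, 0 ≤ g i := fun i => by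
    simp only [hg]
    split_ifs <;> positivity
  have hcoord : ∀ i : Fin d, (w i - wt i) ^ 2 ≤ g i * ‖w‖ ^ 2 := fun i => by
    simp only [hg]
    split_ifs with hi
    · calc (w i - wt i) ^ 2 ≤ (‖w‖ / Real.sqrt (c * k)) ^ 2 :=
            sq_le_sq.2 ((htop i hi).trans (le_abs_self _))
        _ = 1 / (c * k) * ‖w‖ ^ 2 := by
            rw [div_pow, Real.sq_sqrt (by positivity)]
            ring
    · rw [htail i (by omega), sub_zero]
      calc (w i) ^ 2 ≤ (((i : ℕ) + 1 : ℝ) ^ (-p) * ‖w‖) ^ 2 :=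
            sq_le_sq.2 ((hpow i (by omega)).trans (le_abs_self _))
        _ = ((i : ℕ) + 1 : ℝ) ^ (-(2 * p)) * ‖w‖ ^ 2 := by
            rw [mul_pow, ← Real.rpow_mul_natCast (by positivity)]
            congr 2
            push_cast
            ring
  have hhead : ∑ i ∈ range k, g i = 1 / c := by
    rw [sum_congr rfl fun i hi => if_pos (mem_range.1 hi), sum_const, card_range, nsmul_eq_mul]
    field_simp
  have htail_sum : ∑ i ∈ Ico k d, g i ≤
      ((k : ℝ) ^ (1 - 2 * p) - (d : ℝ) ^ (1 - 2 * p)) / (2 * p - 1) := by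
    rw [sum_congr rfl fun i hi => if_neg (mem_Ico.1 hi).1.not_gt]
    exact sum_Ico_rpow_neg_le hk1 hkd (by linarith)
  calc ‖w - wt‖ ^ 2 = ∑ i : Fin d, (w i - wt i) ^ 2 := by
        simp [EuclideanSpace.real_norm_sq_eq]
    _ ≤ ∑ i : Fin d, g i * ‖w‖ ^ 2 := sum_le_sum fun i _ => hcoord i
    _ = (∑ i ∈ range d, g i) * ‖w‖ ^ 2 := by
        rw [← sum_mul, Fin.sum_univ_eq_sum_range]
    _ ≤ (∑ i ∈ range d, g i) * W :=
        mul_le_mul_of_nonneg_left hnorm (sum_nonneg fun i _ => hg0 i)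
    _ ≤ _ := by
        refine mul_le_mul_of_nonneg_right ?_ hW
        rw [← sum_range_add_sum_Ico g hkd, hhead]
        gcongr
end

section
/- Let d be a positive integer, f : ℝ^d → ℝ differentiable with M-Lipschitz gradient (M > 0), let E ≥ 2 be an integer, D ≥ 0, c ≥ 0, and set A = 1 + 2D. Let 0 < γ ≤ 1/(4·E·M·A). Let w ∈ ℝ^d and define iterates w^0 = w and w^e = w^{e−1} − γ·g^{e−1} for 1 ≤ e ≤ E−1, where the vectors g^e ∈ ℝ^d satisfy ‖g^e − ∇f(w^e)‖² ≤ D‖∇f(w^e)‖² + c for all 0 ≤ e ≤ E−1. Then for every e with 0 ≤ e ≤ E−1: ‖w^e − w‖² ≤ 30·E²·γ²·( A·‖∇f(w)‖² + c ). -/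
open Finset

/-- If each increment is at most `γ * (R + L * r)`, where `r` is the current distance to the
starting point, and `2 * γ * L * n ≤ 1`, then the first `n` iterates drift by at most `2 * γ * R`
per step. -/
lemma norm_sub_le_of_norm_step_le {V : Type*} [SeminormedAddCommGroup V] {u : ℕ → V}
    {γ R L : ℝ} {n : ℕ} (hγ : 0 ≤ γ) (hR : 0 ≤ R) (hL : 0 ≤ L) (hn : 2 * (γ * L * n) ≤ 1)
    (hstep : ∀ e < n, ‖u (e + 1) - u e‖ ≤ γ * (R + L * ‖u e - u 0‖)) :
    ∀ e ≤ n, ‖u e - u 0‖ ≤ 2 * e * (γ * R) := by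
  intro e
  induction e with
  | zero => simp
  | succ e ih =>
    intro he
    have hdist := ih (by omega)
    have hcoef : 2 * (γ * L * e) ≤ 1 := by
      refine le_trans ?_ hn
      gcongr
      omega
    have hdrift : γ * L * ‖u e - u 0‖ ≤ γ * R :=
      calc γ * L * ‖u e - u 0‖ ≤ γ * L * (2 * e * (γ * R)) := by gcongr
        _ = 2 * (γ * L * e) * (γ * R) := by ring
        _ ≤ 1 * (γ * R) := by gcongr
        _ = γ * R := one_mul _
    have htri := norm_sub_le_norm_sub_add_norm_sub (u (e + 1)) (u e) (u 0)
    push_cast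
    linarith [hstep e (by omega)]

/-- An approximation `v` of `p` with relative error `D` and additive error `c`, both measured in
squared norm, has norm at most `(1 + √D) * ‖p‖ + √c`. -/
lemma norm_le_of_norm_sub_sq_le {V : Type*} [SeminormedAddCommGroup V] {v p : V} {D c : ℝ}
    (hD : 0 ≤ D) (hc : 0 ≤ c) (h : ‖v - p‖ ^ 2 ≤ D * ‖p‖ ^ 2 + c) :
    ‖v‖ ≤ (1 + √D) * ‖p‖ + √c := by
  have herr : ‖v - p‖ ≤ √D * ‖p‖ + √c := by
    refine (sq_le_sq₀ (norm_nonneg _) (by positivity)).1 ?_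
    have hcross : 0 ≤ √D * ‖p‖ * √c := by positivity
    calc ‖v - p‖ ^ 2 ≤ √D ^ 2 * ‖p‖ ^ 2 + √c ^ 2 := by
          rwa [Real.sq_sqrt hD, Real.sq_sqrt hc]
      _ ≤ (√D * ‖p‖ + √c) ^ 2 := by nlinarith
  linarith [norm_le_norm_add_norm_sub' v p]

/-- Lemma 2 of the paper, deterministic form: drift bound for `E` local
epochs of gradient descent with inexact gradients. -/
theorem local_drift_bound
    (d : ℕ) (hd : 0 < d)
    (f : EuclideanSpace ℝ (Fin d) → ℝ)
    (f' : EuclideanSpace ℝ (Fin d) → EuclideanSpace ℝ (Fin d))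
    (hgrad : ∀ x, HasGradientAt f (f' x) x)
    (M : ℝ) (hM : 0 < M)
    (hlip : ∀ x y, ‖f' x - f' y‖ ≤ M * ‖x - y‖)
    (E : ℕ) (hE : 2 ≤ E)
    (D : ℝ) (hD : 0 ≤ D)
    (c : ℝ) (hc : 0 ≤ c)
    (A : ℝ) (hA : A = 1 + 2 * D)
    (γ : ℝ) (hγ0 : 0 < γ) (hγ : γ ≤ 1 / (4 * E * M * A))
    (w : EuclideanSpace ℝ (Fin d))
    (wseq g : ℕ → EuclideanSpace ℝ (Fin d))
    (hw0 : wseq 0 = w)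
    (hrec : ∀ e : ℕ, e + 1 ≤ E - 1 → wseq (e + 1) = wseq e - γ • g e)
    (herr : ∀ e : ℕ, e ≤ E - 1 → ‖g e - f' (wseq e)‖ ^ 2 ≤ D * ‖f' (wseq e)‖ ^ 2 + c) :
    ∀ e : ℕ, e ≤ E - 1 →
      ‖wseq e - w‖ ^ 2 ≤ 30 * (E : ℝ) ^ 2 * γ ^ 2 * (A * ‖f' w‖ ^ 2 + c) := by
  subst hA hw0
  have hsD : √D ^ 2 = D := Real.sq_sqrt hD
  have hsc : √c ^ 2 = c := Real.sq_sqrt hc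
  have hEpos : (0 : ℝ) < E := by exact_mod_cast (by omega : 0 < E)
  set R := (1 + √D) * ‖f' (wseq 0)‖ + √c with hR
  set L := (1 + √D) * M with hL
  have hR0 : 0 ≤ R := by positivity
  have hL0 : 0 ≤ L := by positivity
  have hγL : 2 * (γ * L * (E - 1 : ℕ)) ≤ 1 := by
    have hγE : γ * (4 * E * M * (1 + 2 * D)) ≤ 1 := (le_div_iff₀ (by positivity)).1 hγ
    have hsle : 1 + √D ≤ 2 * (1 + 2 * D) := by nlinarith [sq_nonneg (√D - 1)]
    calc 2 * (γ * L * (E - 1 : ℕ)) ≤ 2 * (γ * (2 * (1 + 2 * D) * M) * E) := by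
          rw [hL]
          gcongr
          omega
      _ = γ * (4 * E * M * (1 + 2 * D)) := by ring
      _ ≤ 1 := hγE
  have hstep : ∀ e < E - 1,
      ‖wseq (e + 1) - wseq e‖ ≤ γ * (R + L * ‖wseq e - wseq 0‖) := by
    intro e he
    have hgrad_le : ‖f' (wseq e)‖ ≤ ‖f' (wseq 0)‖ + M * ‖wseq e - wseq 0‖ := by
      linarith [norm_le_norm_add_norm_sub' (f' (wseq e)) (f' (wseq 0)), hlip (wseq e) (wseq 0)]
    rw [hrec e he, sub_sub_cancel_left, norm_neg, norm_smul, Real.norm_of_nonneg hγ0.le]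
    gcongr
    calc ‖g e‖ ≤ (1 + √D) * ‖f' (wseq e)‖ + √c := norm_le_of_norm_sub_sq_le hD hc (herr e he.le)
      _ ≤ (1 + √D) * (‖f' (wseq 0)‖ + M * ‖wseq e - wseq 0‖) + √c := by gcongr
      _ = R + L * ‖wseq e - wseq 0‖ := by rw [hR, hL]; ring
  have hRsq : 4 * R ^ 2 ≤ 30 * ((1 + 2 * D) * ‖f' (wseq 0)‖ ^ 2 + c) := by
    have hs : (1 + √D) ^ 2 ≤ 2 * (1 + 2 * D) := by nlinarith [sq_nonneg (√D - 1)]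
    calc 4 * R ^ 2 ≤ 4 * (2 * (((1 + √D) * ‖f' (wseq 0)‖) ^ 2 + √c ^ 2)) := by
          gcongr
          exact add_sq_le
      _ = 8 * ((1 + √D) ^ 2 * ‖f' (wseq 0)‖ ^ 2 + c) := by rw [hsc]; ring
      _ ≤ 8 * (2 * (1 + 2 * D) * ‖f' (wseq 0)‖ ^ 2 + c) := by gcongr
      _ ≤ 30 * ((1 + 2 * D) * ‖f' (wseq 0)‖ ^ 2 + c) := by
          have : 0 ≤ (1 + 2 * D) * ‖f' (wseq 0)‖ ^ 2 := by positivity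
          linarith
  intro e he
  calc ‖wseq e - wseq 0‖ ^ 2 ≤ (2 * e * (γ * R)) ^ 2 := by
        gcongr
        exact norm_sub_le_of_norm_step_le hγ0.le hR0 hL0 hγL hstep e he
    _ ≤ (2 * E * (γ * R)) ^ 2 := by
        gcongr
        omega
    _ = (E : ℝ) ^ 2 * γ ^ 2 * (4 * R ^ 2) := by ring
    _ ≤ (E : ℝ) ^ 2 * γ ^ 2 * (30 * ((1 + 2 * D) * ‖f' (wseq 0)‖ ^ 2 + c)) := by gcongr
    _ = _ := by ring
end

section
/- Let d be a positive integer, f : ℝ^d → ℝ differentiable with M-Lipschitz gradient (M ≥ 0), let E ≥ 1 be an integer, γ > 0, D ≥ 0, c ≥ 0. Let u, w, g ∈ ℝ^d with ‖g − ∇f(u)‖² ≤ D‖∇f(u)‖² + c. Then ‖(u − γg) − w‖² ≤ ( 1 + 1/(2E−1) + 6·E·γ²·M²·(1+2D) )·‖u − w‖² + 6·E·γ²·( (1+2D)·‖∇f(w)‖² + c ). -/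
/-- Young's inequality for the squared norm of a difference. -/
theorem norm_sub_sq_le_one_add_inv_mul {V : Type*} [SeminormedAddCommGroup V]
    {t : ℝ} (ht : 0 < t) (x y : V) :
    ‖x - y‖ ^ 2 ≤ (1 + 1 / t) * ‖x‖ ^ 2 + (1 + t) * ‖y‖ ^ 2 := by
  have hyoung : (1 + 1 / t) * ‖x‖ ^ 2 + (1 + t) * ‖y‖ ^ 2 - (‖x‖ + ‖y‖) ^ 2
      = (‖x‖ - t * ‖y‖) ^ 2 / t := by
    field_simp
    ring
  have hnonneg : 0 ≤ (‖x‖ - t * ‖y‖) ^ 2 / t := by positivity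
  have htri : ‖x - y‖ ^ 2 ≤ (‖x‖ + ‖y‖) ^ 2 := by
    gcongr
    exact norm_sub_le x y
  linarith

/-- A vector approximating `v` up to a relative-plus-additive error is controlled by the distance
from `v` to a reference vector `v₀` and the size of `v₀`. -/
theorem norm_sq_le_of_norm_sub_sq_le {V : Type*} [SeminormedAddCommGroup V]
    {D c : ℝ} (hD : 0 ≤ D) {g v : V} (v₀ : V) (herr : ‖g - v‖ ^ 2 ≤ D * ‖v‖ ^ 2 + c) :
    ‖g‖ ^ 2 ≤ 3 * ((1 + 2 * D) * (‖v - v₀‖ ^ 2 + ‖v₀‖ ^ 2) + c) := by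
  have hv : ‖v‖ ^ 2 ≤ 2 * (‖v - v₀‖ ^ 2 + ‖v₀‖ ^ 2) := by
    have h : ‖v‖ ≤ ‖v - v₀‖ + ‖v₀‖ := by simpa using norm_add_le (v - v₀) v₀
    calc ‖v‖ ^ 2 ≤ (‖v - v₀‖ + ‖v₀‖) ^ 2 := by gcongr
      _ ≤ 2 * (‖v - v₀‖ ^ 2 + ‖v₀‖ ^ 2) := add_sq_le
  have hg : ‖g‖ ^ 2 ≤ 3 * (‖g - v‖ ^ 2 + ‖v - v₀‖ ^ 2 + ‖v₀‖ ^ 2) := by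
    have h : ‖g‖ ≤ ‖g - v‖ + ‖v - v₀‖ + ‖v₀‖ := by
      simpa using norm_add₃_le (a := g - v) (b := v - v₀) (c := v₀)
    calc ‖g‖ ^ 2 ≤ (‖g - v‖ + ‖v - v₀‖ + ‖v₀‖) ^ 2 := by gcongr
      _ ≤ 3 * (‖g - v‖ ^ 2 + ‖v - v₀‖ ^ 2 + ‖v₀‖ ^ 2) := by
        linarith [sq_nonneg (‖g - v‖ - ‖v - v₀‖), sq_nonneg (‖g - v‖ - ‖v₀‖),
          sq_nonneg (‖v - v₀‖ - ‖v₀‖)]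
  linarith [mul_le_mul_of_nonneg_left hv hD]

/-- single-step drift recursion from the proof of Lemma 2. -/
theorem single_step_drift
    (d : ℕ) (hd : 0 < d)
    (f : EuclideanSpace ℝ (Fin d) → ℝ)
    (f' : EuclideanSpace ℝ (Fin d) → EuclideanSpace ℝ (Fin d))
    (hgrad : ∀ x, HasGradientAt f (f' x) x)
    (M : ℝ) (hM : 0 ≤ M)
    (hlip : ∀ x y, ‖f' x - f' y‖ ≤ M * ‖x - y‖)
    (E : ℕ) (hE : 1 ≤ E)
    (γ : ℝ) (hγ : 0 < γ)
    (D : ℝ) (hD : 0 ≤ D)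
    (c : ℝ) (hc : 0 ≤ c)
    (u w g : EuclideanSpace ℝ (Fin d))
    (herr : ‖g - f' u‖ ^ 2 ≤ D * ‖f' u‖ ^ 2 + c) :
    ‖(u - γ • g) - w‖ ^ 2 ≤
      (1 + 1 / (2 * (E : ℝ) - 1) + 6 * E * γ ^ 2 * M ^ 2 * (1 + 2 * D)) * ‖u - w‖ ^ 2
        + 6 * E * γ ^ 2 * ((1 + 2 * D) * ‖f' w‖ ^ 2 + c) := by
  have hE' : (1 : ℝ) ≤ E := by exact_mod_cast hE
  have hyoung := norm_sub_sq_le_one_add_inv_mul (t := 2 * (E : ℝ) - 1) (by linarith)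
    (u - w) (γ • g)
  rw [norm_smul, mul_pow, Real.norm_eq_abs, sq_abs] at hyoung
  have hdrift : ‖f' u - f' w‖ ^ 2 ≤ M ^ 2 * ‖u - w‖ ^ 2 := by
    rw [← mul_pow]
    gcongr
    exact hlip u w
  have hg : ‖g‖ ^ 2 ≤ 3 * ((1 + 2 * D) * (M ^ 2 * ‖u - w‖ ^ 2 + ‖f' w‖ ^ 2) + c) :=
    (norm_sq_le_of_norm_sub_sq_le hD (f' w) herr).trans (by gcongr)
  rw [sub_right_comm]
  calc ‖u - w - γ • g‖ ^ 2
      ≤ (1 + 1 / (2 * (E : ℝ) - 1)) * ‖u - w‖ ^ 2 + 2 * E * γ ^ 2 * ‖g‖ ^ 2 := by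
        linarith
    _ ≤ (1 + 1 / (2 * (E : ℝ) - 1)) * ‖u - w‖ ^ 2 + 2 * E * γ ^ 2 *
          (3 * ((1 + 2 * D) * (M ^ 2 * ‖u - w‖ ^ 2 + ‖f' w‖ ^ 2) + c)) := by gcongr
    _ = _ := by ring
end

section
/- Let d be a positive integer, let (Ω, F, μ) be a probability space, and let f : ℝ^d → ℝ be differentiable with L-Lipschitz gradient (L > 0). Fix w ∈ ℝ^d, β ∈ ℝ^d, and let g : Ω → ℝ^d be integrable with ∫ g dμ = ∇f(w) + β, with ω ↦ ‖g(ω)‖² integrable and ω ↦ f(w − γ g(ω)) integrable. If 0 < γ ≤ 1/(2L), then ∫ f(w − γ g(ω)) dμ(ω) ≤ f(w) − (γ/2)‖∇f(w)‖² + (γ/2)‖β‖² + (L·γ²/2)·∫ ‖g(ω) − (∇f(w) + β)‖² dμ(ω). -/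
open MeasureTheory

open scoped RealInnerProductSpace

section InnerProductSpace

variable {E : Type*} [NormedAddCommGroup E] [InnerProductSpace ℝ E] [CompleteSpace E]

/-- The quadratic upper bound for a function with `L`-Lipschitz gradient. -/
theorem le_add_inner_add_sq_of_lipschitz_gradient {f : E → ℝ} {f' : E → E} {L : ℝ}
    (hgrad : ∀ x, HasGradientAt f (f' x) x)
    (hlip : ∀ x y, ‖f' x - f' y‖ ≤ L * ‖x - y‖) (x v : E) :
    f (x + v) ≤ f x + ⟪f' x, v⟫ + L / 2 * ‖v‖ ^ 2 := by
  have hderiv (t : ℝ) :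
      HasDerivAt (fun s : ℝ => f (x + s • v)) ⟪f' (x + t • v), v⟫ t := by
    have hline : HasDerivAt (fun s : ℝ => x + s • v) v t := by
      simpa using ((hasDerivAt_id t).smul_const v).const_add x
    simpa [Function.comp_def] using
      (hgrad (x + t • v)).hasFDerivAt.comp_hasDerivAt t hline
  have hbound (t : ℝ) :
      HasDerivAt (fun s : ℝ => f x + s * ⟪f' x, v⟫ + L / 2 * ‖v‖ ^ 2 * s ^ 2)
        (⟪f' x, v⟫ + L * ‖v‖ ^ 2 * t) t := by
    refine ((((hasDerivAt_id t).mul_const ⟪f' x, v⟫).const_add (f x)).add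
      ((hasDerivAt_pow 2 t).const_mul (L / 2 * ‖v‖ ^ 2))).congr_deriv ?_
    norm_num
    ring
  have key := image_le_of_deriv_right_le_deriv_boundary (a := 0) (b := 1)
    (fun t _ => (hderiv t).continuousAt.continuousWithinAt)
    (fun t _ => (hderiv t).hasDerivWithinAt) (by simp)
    (fun t _ => (hbound t).continuousAt.continuousWithinAt)
    (fun t _ => (hbound t).hasDerivWithinAt)
    (fun t ht => by
      have hinner : ⟪f' (x + t • v) - f' x, v⟫ ≤ L * ‖v‖ ^ 2 * t :=
        calc ⟪f' (x + t • v) - f' x, v⟫ ≤ ‖f' (x + t • v) - f' x‖ * ‖v‖ :=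
              real_inner_le_norm _ _
          _ ≤ L * ‖x + t • v - x‖ * ‖v‖ := by gcongr; exact hlip _ _
          _ = L * ‖v‖ ^ 2 * t := by
              rw [add_sub_cancel_left, norm_smul, Real.norm_of_nonneg ht.1]
              ring
      rw [inner_sub_left] at hinner
      linarith)
    (Set.right_mem_Icc.2 zero_le_one)
  simpa using key

/-- The variance of a vector-valued random variable is its second moment minus the squared norm
of its mean. -/
theorem integral_norm_sub_integral_sq {Ω : Type*} [MeasurableSpace Ω] {μ : Measure Ω}
    [IsProbabilityMeasure μ] {g : Ω → E} (hg : Integrable g μ)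
    (hg2 : Integrable (fun ω => ‖g ω‖ ^ 2) μ) :
    ∫ ω, ‖g ω - ∫ ω', g ω' ∂μ‖ ^ 2 ∂μ = ∫ ω, ‖g ω‖ ^ 2 ∂μ - ‖∫ ω, g ω ∂μ‖ ^ 2 := by
  set m := ∫ ω, g ω ∂μ with hm
  have hin : Integrable (fun ω => 2 * ⟪m, g ω⟫) μ := (hg.const_inner m).const_mul 2
  simp_rw [norm_sub_sq_real, real_inner_comm m]
  have hdiff : Integrable (fun ω => ‖g ω‖ ^ 2 - 2 * ⟪m, g ω⟫) μ := hg2.sub hin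
  rw [integral_add hdiff (integrable_const _), integral_sub hg2 hin, integral_const_mul,
    integral_inner hg, ← hm, real_inner_self_eq_norm_sq]
  simp
  ring

end InnerProductSpace

/-- one-step expected-descent inequality, core of equation (30) in the
proof of Theorem 1: `g` is a biased stochastic gradient at `w` with mean `∇f(w) + β`. -/
theorem expected_descent_step
    (d : ℕ) (hd : 0 < d)
    {Ω : Type*} [MeasurableSpace Ω] (μ : Measure Ω) [IsProbabilityMeasure μ]
    (f : EuclideanSpace ℝ (Fin d) → ℝ)
    (f' : EuclideanSpace ℝ (Fin d) → EuclideanSpace ℝ (Fin d))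
    (hgrad : ∀ x, HasGradientAt f (f' x) x)
    (L : ℝ) (hL : 0 < L)
    (hlip : ∀ x y, ‖f' x - f' y‖ ≤ L * ‖x - y‖)
    (γ : ℝ) (hγ0 : 0 < γ) (hγ : γ ≤ 1 / (2 * L))
    (w β : EuclideanSpace ℝ (Fin d))
    (g : Ω → EuclideanSpace ℝ (Fin d))
    (hgint : Integrable g μ)
    (hmean : ∫ ω, g ω ∂μ = f' w + β)
    (hg2int : Integrable (fun ω => ‖g ω‖ ^ 2) μ)
    (hfint : Integrable (fun ω => f (w - γ • g ω)) μ) :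
    ∫ ω, f (w - γ • g ω) ∂μ ≤
      f w - (γ / 2) * ‖f' w‖ ^ 2 + (γ / 2) * ‖β‖ ^ 2
        + (L * γ ^ 2 / 2) * ∫ ω, ‖g ω - (f' w + β)‖ ^ 2 ∂μ := by
  have hquad (ω : Ω) : f (w - γ • g ω) ≤
      f w - γ * ⟪f' w, g ω⟫ + L * γ ^ 2 / 2 * ‖g ω‖ ^ 2 := by
    have h := le_add_inner_add_sq_of_lipschitz_gradient hgrad hlip w (-(γ • g ω))
    rw [← sub_eq_add_neg, inner_neg_right, real_inner_smul_right, norm_neg, norm_smul,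
      Real.norm_of_nonneg hγ0.le] at h
    linarith
  have hin : Integrable (fun ω => γ * ⟪f' w, g ω⟫) μ := (hgint.const_inner _).const_mul γ
  have hsq : Integrable (fun ω => L * γ ^ 2 / 2 * ‖g ω‖ ^ 2) μ := hg2int.const_mul _
  have hlin : Integrable (fun ω => f w - γ * ⟪f' w, g ω⟫) μ := (integrable_const _).sub hin
  have hexp := integral_mono hfint (hlin.add hsq) hquad
  simp only [Pi.add_apply] at hexp
  rw [integral_add hlin hsq, integral_sub (integrable_const _) hin, integral_const_mul,
    integral_const_mul, integral_inner hgint, hmean] at hexp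
  simp only [integral_const, probReal_univ, one_smul] at hexp
  have hvar := integral_norm_sub_integral_sq hgint hg2int
  rw [hmean] at hvar
  rw [hvar]
  have hpolar : ‖β‖ ^ 2 = ‖f' w + β‖ ^ 2 - 2 * ⟪f' w, f' w + β⟫ + ‖f' w‖ ^ 2 := by
    rw [inner_add_right, norm_add_sq_real, real_inner_self_eq_norm_sq]
    ring
  have hstep : L * γ ≤ 1 := by
    rw [le_div_iff₀ (by positivity)] at hγ
    linarith
  have hmul : L * γ * (γ * ‖f' w + β‖ ^ 2) ≤ 1 * (γ * ‖f' w + β‖ ^ 2) := by gcongr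
  rw [hpolar]
  linarith
end

section
/- Let d be a positive integer, E ≥ 1 an integer, P_b, B, b² ≥ 0, A ≥ 1, c ≥ 0, f : ℝ^d → ℝ differentiable, and w, w^0, …, w^{E−1} ∈ ℝ^d. Suppose vectors β^0, …, β^{E−1} ∈ ℝ^d satisfy ‖β^e‖² ≤ P_b·B²·‖∇f(w^e)‖² + b² for every e, and that E·∑_{e=0}^{E−1} ‖∇f(w^e) − ∇f(w)‖² ≤ (2E²/A²)·( A·‖∇f(w)‖² + c ). Then ‖∑_{e=0}^{E−1} β^e‖² ≤ 2·P_b·B²·E²·(1 + 2/A)·‖∇f(w)‖² + E²·b² + (4·P_b·B²·E²/A²)·c. -/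
open Finset

/-- The squared norm of a sum is at most the number of terms times the sum of squared norms. -/
theorem norm_sum_sq_le_card_mul_sum_norm_sq {ι V : Type*} [SeminormedAddCommGroup V]
    (s : Finset ι) (v : ι → V) :
    ‖∑ i ∈ s, v i‖ ^ 2 ≤ (s.card : ℝ) * ∑ i ∈ s, ‖v i‖ ^ 2 :=
  (pow_le_pow_left₀ (norm_nonneg _) (norm_sum_le s v) 2).trans sq_sum_le_card_mul_sum_sq

/-- A vector's squared norm is at most twice the squared distance to `y` plus `2 * ‖y‖ ^ 2`. -/
theorem norm_sq_le_two_mul_norm_sub_sq_add {V : Type*} [SeminormedAddCommGroup V] (x y : V) :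
    ‖x‖ ^ 2 ≤ 2 * ‖x - y‖ ^ 2 + 2 * ‖y‖ ^ 2 := by
  have h : ‖x‖ ≤ ‖x - y‖ + ‖y‖ := by simpa using norm_add_le (x - y) y
  nlinarith [norm_nonneg x, sq_nonneg (‖x - y‖ - ‖y‖)]

/-- aggregated-bias second-moment bound, analogue of equation (38). -/
theorem aggregated_bias_bound
    (d : ℕ) (hd : 0 < d)
    (E : ℕ) (hE : 1 ≤ E)
    (Pb B bsq : ℝ) (hPb : 0 ≤ Pb) (hB : 0 ≤ B) (hbsq : 0 ≤ bsq)
    (A : ℝ) (hA : 1 ≤ A)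
    (c : ℝ) (hc : 0 ≤ c)
    (f : EuclideanSpace ℝ (Fin d) → ℝ)
    (f' : EuclideanSpace ℝ (Fin d) → EuclideanSpace ℝ (Fin d))
    (hgrad : ∀ x, HasGradientAt f (f' x) x)
    (w : EuclideanSpace ℝ (Fin d))
    (wseq β : ℕ → EuclideanSpace ℝ (Fin d))
    (hβ : ∀ e ∈ Finset.range E, ‖β e‖ ^ 2 ≤ Pb * B ^ 2 * ‖f' (wseq e)‖ ^ 2 + bsq)
    (hdev : (E : ℝ) * ∑ e ∈ Finset.range E, ‖f' (wseq e) - f' w‖ ^ 2 ≤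
      (2 * (E : ℝ) ^ 2 / A ^ 2) * (A * ‖f' w‖ ^ 2 + c)) :
    ‖∑ e ∈ Finset.range E, β e‖ ^ 2 ≤
      2 * Pb * B ^ 2 * (E : ℝ) ^ 2 * (1 + 2 / A) * ‖f' w‖ ^ 2
        + (E : ℝ) ^ 2 * bsq + (4 * Pb * B ^ 2 * (E : ℝ) ^ 2 / A ^ 2) * c := by
  have hA0 : A ≠ 0 := (zero_lt_one.trans_le hA).ne'
  have hK : 0 ≤ Pb * B ^ 2 := by positivity
  have hterm : ∀ e ∈ Finset.range E, ‖β e‖ ^ 2 ≤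
      2 * (Pb * B ^ 2) * ‖f' (wseq e) - f' w‖ ^ 2 + (2 * (Pb * B ^ 2) * ‖f' w‖ ^ 2 + bsq) := by
    intro e he
    have h := mul_le_mul_of_nonneg_left
      (norm_sq_le_two_mul_norm_sub_sq_add (f' (wseq e)) (f' w)) hK
    linarith [hβ e he]
  calc ‖∑ e ∈ Finset.range E, β e‖ ^ 2
      ≤ (E : ℝ) * ∑ e ∈ Finset.range E, ‖β e‖ ^ 2 := by
        simpa using norm_sum_sq_le_card_mul_sum_norm_sq (Finset.range E) β
    _ ≤ (E : ℝ) * ∑ e ∈ Finset.range E, (2 * (Pb * B ^ 2) * ‖f' (wseq e) - f' w‖ ^ 2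
          + (2 * (Pb * B ^ 2) * ‖f' w‖ ^ 2 + bsq)) := by
        gcongr with e he
        exact hterm e he
    _ = 2 * (Pb * B ^ 2) * ((E : ℝ) * ∑ e ∈ Finset.range E, ‖f' (wseq e) - f' w‖ ^ 2)
          + (E : ℝ) ^ 2 * (2 * (Pb * B ^ 2) * ‖f' w‖ ^ 2 + bsq) := by
        rw [Finset.sum_add_distrib, ← Finset.mul_sum, Finset.sum_const, Finset.card_range,
          nsmul_eq_mul]
        ring
    _ ≤ 2 * (Pb * B ^ 2) * ((2 * (E : ℝ) ^ 2 / A ^ 2) * (A * ‖f' w‖ ^ 2 + c))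
          + (E : ℝ) ^ 2 * (2 * (Pb * B ^ 2) * ‖f' w‖ ^ 2 + bsq) := by
        gcongr
    _ = 2 * Pb * B ^ 2 * (E : ℝ) ^ 2 * (1 + 2 / A) * ‖f' w‖ ^ 2
          + (E : ℝ) ^ 2 * bsq + (4 * Pb * B ^ 2 * (E : ℝ) ^ 2 / A ^ 2) * c := by
        field_simp
        ring
end
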